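/- Let d ≥ 1 and let h be a smooth solution on [0,T] of the mean-curvature equation ∂_t h + √(1+|∇h|^2) κ = 0 on 𝕋^d, where κ = −div( ∇h / √(1+|∇h|^2) ). Then for every t ∈ [0,T], (d/dt) ∫_{𝕋^d} |∇h(t,x)|^2 dx ≤ 0. -/

import Mathlib

open MeasureTheory Real

/-- Partial derivative `∂ᵢ f` of a function on `ℝᵈ` (as `EuclideanSpace`). -/
noncomputable def pder {d : ℕ} (i : Fin d) (f : EuclideanSpace ℝ (Fin d) → ℝ)
    (x : EuclideanSpace ℝ (Fin d)) : ℝ :=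
  fderiv ℝ f x (EuclideanSpace.single i 1)

/-- The Laplacian `Δ f = ∑ᵢ ∂ᵢ∂ᵢ f`. -/
noncomputable def lap {d : ℕ} (f : EuclideanSpace ℝ (Fin d) → ℝ)
    (x : EuclideanSpace ℝ (Fin d)) : ℝ :=
  ∑ i, pder i (pder i f) x

/-- Squared norm of the gradient, `|∇f|² = ∑ᵢ (∂ᵢ f)²`. -/
noncomputable def gradSq {d : ℕ} (f : EuclideanSpace ℝ (Fin d) → ℝ)
    (x : EuclideanSpace ℝ (Fin d)) : ℝ :=
  ∑ i, (pder i f x) ^ 2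

/-- Squared Frobenius norm of the Hessian, `|∇∇f|² = ∑ᵢⱼ (∂ᵢ∂ⱼ f)²`. -/
noncomputable def hessSq {d : ℕ} (f : EuclideanSpace ℝ (Fin d) → ℝ)
    (x : EuclideanSpace ℝ (Fin d)) : ℝ :=
  ∑ i, ∑ j, (pder i (pder j f) x) ^ 2

/-- The fundamental domain `[0,1)^d` of the torus `𝕋^d`. -/
def fundDom (d : ℕ) : Set (EuclideanSpace ℝ (Fin d)) :=
  {x | ∀ i, 0 ≤ x i ∧ x i < 1}

/-- `ℤ^d`-periodicity of a function on `ℝ^d`. -/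
def ZPeriodic {d : ℕ} (f : EuclideanSpace ℝ (Fin d) → ℝ) : Prop :=
  ∀ (x : EuclideanSpace ℝ (Fin d)) (k : Fin d → ℤ),
    f (x + (WithLp.equiv 2 (Fin d → ℝ)).symm (fun i => (k i : ℝ))) = f x


open scoped ContDiff

variable {d : ℕ}

lemma pder_smooth (i : Fin d) {f : EuclideanSpace ℝ (Fin d) → ℝ} (hf : ContDiff ℝ ∞ f) :
    ContDiff ℝ ∞ (pder i f) := by
  unfold pder
  exact (hf.fderiv_right (m := ∞) (by simp)).clm_apply contDiff_const

lemma pder_per (i : Fin d) {f : EuclideanSpace ℝ (Fin d) → ℝ} (hf : ZPeriodic f) :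
    ZPeriodic (pder i f) := by
  intro x k
  unfold pder
  rw [← fderiv_comp_add_right]
  congr 2
  funext y
  exact hf y k

lemma pder_comm (i j : Fin d) {f : EuclideanSpace ℝ (Fin d) → ℝ} (hf : ContDiff ℝ ∞ f) :
    pder i (pder j f) = pder j (pder i f) := by
  funext x
  have hd : DifferentiableAt ℝ (fderiv ℝ f) x :=
    (hf.fderiv_right (m := ∞) (by simp)).contDiffAt.differentiableAt (by simp)
  have key : ∀ a b : Fin d, pder a (pder b f) x
      = fderiv ℝ (fderiv ℝ f) x (EuclideanSpace.single a 1) (EuclideanSpace.single b 1) := by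
    intro a b
    unfold pder
    rw [fderiv_clm_apply hd (by fun_prop)]
    simp
  rw [key, key]
  exact (hf.contDiffAt.isSymmSndFDerivAt (by simp; exact WithTop.coe_le_coe.2 (le_top : (2 : ℕ∞) ≤ ⊤))) _ _

lemma integrable_fund {f : EuclideanSpace ℝ (Fin d) → ℝ} (hf : Continuous f) :
    IntegrableOn f (fundDom d) := by
  have hc : IsCompact ((WithLp.toLp 2) '' (Set.Icc (0 : Fin d → ℝ) 1)) :=
    isCompact_Icc.image (PiLp.continuous_toLp 2 _)
  refine (hf.continuousOn.integrableOn_compact hc).mono_set ?_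
  intro x hx
  exact ⟨x.ofLp, ⟨fun i => (hx i).1, fun i => (hx i).2.le⟩, rfl⟩

lemma meas_fund : MeasurableSet (fundDom d) := by
  have : fundDom d = ⋂ i, {x : EuclideanSpace ℝ (Fin d) | 0 ≤ x i ∧ x i < 1} := by
    ext x; simp [fundDom]
  rw [this]
  refine MeasurableSet.iInter fun i => ?_
  have h1 : Measurable fun x : EuclideanSpace ℝ (Fin d) => x i :=
    (by fun_prop : Continuous fun x : EuclideanSpace ℝ (Fin d) => x i).measurable
  exact (measurableSet_le measurable_const h1).inter (measurableSet_lt h1 measurable_const)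

lemma integral_fund (f : EuclideanSpace ℝ (Fin d) → ℝ) :
    ∫ x in fundDom d, f x = ∫ y in Set.Icc (0 : Fin d → ℝ) 1, f (WithLp.toLp 2 y) := by
  have hp := (PiLp.volume_preserving_toLp (Fin d)).setIntegral_preimage_emb
    (MeasurableEquiv.toLp 2 (Fin d → ℝ)).measurableEmbedding f (fundDom d)
  rw [← hp]
  refine setIntegral_congr_set ?_
  have : (WithLp.toLp 2 ⁻¹' fundDom d : Set (Fin d → ℝ))
      = Set.pi Set.univ fun i => Set.Ico ((0 : Fin d → ℝ) i) ((1 : Fin d → ℝ) i) := by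
    ext y; simp [fundDom]
  rw [this]
  exact Measure.univ_pi_Ico_ae_eq_Icc

lemma pder_mul (i : Fin d) {f g : EuclideanSpace ℝ (Fin d) → ℝ} (hf : ContDiff ℝ ∞ f)
    (hg : ContDiff ℝ ∞ g) (x) :
    pder i (fun y => f y * g y) x = pder i f x * g x + f x * pder i g x := by
  unfold pder
  rw [fderiv_fun_mul (hf.differentiable (by simp) x) (hg.differentiable (by simp) x)]
  simp
  ring

lemma int_pder_zero (i : Fin d) {f : EuclideanSpace ℝ (Fin d) → ℝ} (hf : ContDiff ℝ ∞ f)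
    (hp : ZPeriodic f) : ∫ x in fundDom d, pder i f x = 0 := by
  obtain ⟨n, rfl⟩ : ∃ n, d = n + 1 := ⟨d - 1, by have := i.pos; omega⟩
  rw [integral_fund]
  let L : (Fin (n+1) → ℝ) →L[ℝ] EuclideanSpace ℝ (Fin (n+1)) :=
    ((PiLp.continuousLinearEquiv 2 ℝ (fun _ : Fin (n+1) => ℝ)).symm : _ →L[ℝ] _)
  have hL : ∀ y, L y = WithLp.toLp 2 y := fun y => rfl
  let F : Fin (n+1) → (Fin (n+1) → ℝ) → ℝ := fun j y => if j = i then f (L y) else 0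
  let F' : Fin (n+1) → (Fin (n+1) → ℝ) → (Fin (n+1) → ℝ) →L[ℝ] ℝ :=
    fun j y => if j = i then (fderiv ℝ f (L y)).comp L else 0
  have hF : ∀ j x, HasFDerivAt (F j) (F' j x) x := by
    intro j x
    by_cases hj : j = i
    · simp only [F, F', hj, if_true]
      exact ((hf.differentiable (by simp) (L x)).hasFDerivAt).comp x L.hasFDerivAt
    · simp only [F, F', hj, if_false]
      exact hasFDerivAt_const _ _
  have hsum : ∀ y, ∑ j, F' j y (Pi.single j 1) = pder i f (WithLp.toLp 2 y) := by
    intro y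
    rw [Finset.sum_eq_single i]
    · simp only [F', if_true]
      rfl
    · intro b _ hb; simp [F', hb]
    · simp
  have key := integral_divergence_of_hasFDerivAt_off_countable' (0 : Fin (n+1) → ℝ) 1
    (by intro j; simp) F F' ∅ Set.countable_empty
    (fun j => (continuous_iff_continuousAt.2 fun x => (hF j x).continuousAt).continuousOn)
    (fun x _ j => hF j x)
    (by
      simp_rw [hsum]
      exact (((pder_smooth i hf).continuous.comp
        (PiLp.continuous_toLp 2 _)).continuousOn).integrableOn_compact isCompact_Icc)
  simp_rw [hsum] at key
  rw [key]
  refine Finset.sum_eq_zero fun j _ => ?_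
  rw [sub_eq_zero]
  congr 1
  funext x
  by_cases hj : j = i
  · simp only [F, hj, if_true, hL]
    have := hp (WithLp.toLp 2 (i.insertNth (0:ℝ) x)) (Pi.single i 1)
    rw [Pi.zero_apply, ← this]
    congr 1
    ext k
    refine Fin.succAboveCases i ?_ (fun k => ?_) k
    · simp
    · simp
  · simp [F, hj]

lemma per_mul {f g : EuclideanSpace ℝ (Fin d) → ℝ} (hf : ZPeriodic f) (hg : ZPeriodic g) :
    ZPeriodic (fun x => f x * g x) := by
  intro x k
  simp only [hf x k, hg x k]

lemma ibp (i : Fin d) {f g : EuclideanSpace ℝ (Fin d) → ℝ} (hf : ContDiff ℝ ∞ f)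
    (hg : ContDiff ℝ ∞ g) (hfp : ZPeriodic f) (hgp : ZPeriodic g) :
    ∫ x in fundDom d, f x * pder i g x = - ∫ x in fundDom d, pder i f x * g x := by
  have h0 := int_pder_zero i (hf.mul hg) (per_mul hfp hgp)
  simp_rw [pder_mul i hf hg] at h0
  rw [integral_add (integrable_fund ((pder_smooth i hf).mul hg).continuous)
    (integrable_fund (hf.mul (pder_smooth i hg)).continuous)] at h0
  linarith

lemma lap_smooth {f : EuclideanSpace ℝ (Fin d) → ℝ} (hf : ContDiff ℝ ∞ f) :
    ContDiff ℝ ∞ (lap f) := by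
  unfold lap
  exact ContDiff.sum fun i _ => pder_smooth i (pder_smooth i hf)

lemma hess_smooth {f : EuclideanSpace ℝ (Fin d) → ℝ} (hf : ContDiff ℝ ∞ f) :
    ContDiff ℝ ∞ (hessSq f) := by
  unfold hessSq
  exact ContDiff.sum fun i _ => ContDiff.sum fun j _ => (pder_smooth i (pder_smooth j hf)).pow 2

lemma int_lap_sq {f : EuclideanSpace ℝ (Fin d) → ℝ} (hf : ContDiff ℝ ∞ f)
    (hp : ZPeriodic f) :
    ∫ x in fundDom d, lap f x ^ 2 = ∫ x in fundDom d, hessSq f x := by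
  have hs := fun i j => pder_smooth i (pder_smooth j hf)
  have hpp := fun i j => pder_per i (pder_per j hp)
  have h1 : ∀ x, lap f x ^ 2 = ∑ i, ∑ j, pder i (pder i f) x * pder j (pder j f) x := by
    intro x
    rw [sq, lap, Finset.sum_mul_sum]
  simp_rw [h1, hessSq]
  rw [integral_finsetSum _ fun i _ => integrable_fund
      (ContDiff.sum fun j _ => (hs i i).mul (hs j j)).continuous,
    integral_finsetSum _ fun i _ => integrable_fund
      (ContDiff.sum fun j _ => (hs i j).pow 2).continuous]
  refine Finset.sum_congr rfl fun i _ => ?_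
  rw [integral_finsetSum _ fun j _ => integrable_fund ((hs i i).mul (hs j j)).continuous,
    integral_finsetSum _ fun j _ => integrable_fund ((hs i j).pow 2).continuous]
  refine Finset.sum_congr rfl fun j _ => ?_
  rw [ibp j (hs i i) (pder_smooth j hf) (hpp i i) (pder_per j hp)]
  have h2 : pder j (pder i (pder i f)) = pder i (pder i (pder j f)) := by
    rw [pder_comm j i (pder_smooth i hf), pder_comm j i hf]
  rw [h2]
  have := ibp i (pder_smooth j hf) (hs i j) (pder_per j hp) (hpp i j)
  simp_rw [sq]
  rw [← neg_eq_iff_eq_neg] at this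
  rw [← this]
  simp_rw [mul_comm]

/-- key pointwise computation -/
lemma pointwise {f : EuclideanSpace ℝ (Fin d) → ℝ} (hf : ContDiff ℝ ∞ f) (x) :
    (lap f x ^ 2 - hessSq f x) / 2 ≤ lap f x * (Real.sqrt (1 + gradSq f x) *
      ∑ i, pder i (fun y => pder i f y / Real.sqrt (1 + gradSq f y)) x) := by
  have hg0 : ∀ y, 0 ≤ gradSq f y := fun y => Finset.sum_nonneg fun i _ => sq_nonneg _
  have hpd : ∀ i y, HasFDerivAt (pder i f) (fderiv ℝ (pder i f) y) y := fun i y =>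
    ((pder_smooth i hf).differentiable (by simp) y).hasFDerivAt
  set q := gradSq f x with hq
  have hq0 : 0 < 1 + q := by have := hg0 x; linarith
  set s := Real.sqrt (1 + q) with hs
  have hs0 : 0 < s := Real.sqrt_pos.2 hq0
  have hs2 : s ^ 2 = 1 + q := Real.sq_sqrt hq0.le
  have hgr : HasFDerivAt (fun y => 1 + gradSq f y)
      (∑ j, (2 * pder j f x) • fderiv ℝ (pder j f) x) x := by
    refine HasFDerivAt.const_add _ ?_
    unfold gradSq
    refine HasFDerivAt.fun_sum fun j _ => ?_
    simpa using (hpd j x).pow 2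
  have hsq := hgr.sqrt hq0.ne'
  have hterm : ∀ i, s * pder i (fun y => pder i f y / Real.sqrt (1 + gradSq f y)) x
      = pder i (pder i f) x - (∑ j, pder i f x * pder j f x * pder i (pder j f) x) / (1 + q) := by
    intro i
    have hdv := (hpd i x).mul ((hasDerivAt_inv hs0.ne').comp_hasFDerivAt x hsq)
    have hfe : (fun y => pder i f y / Real.sqrt (1 + gradSq f y)) = pder i f * (Inv.inv ∘ fun y => Real.sqrt (1 + gradSq f y)) := by
      funext y; simp [div_eq_mul_inv]
    conv_lhs => rw [pder, hfe, hdv.fderiv]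
    have e : ∀ j, fderiv ℝ (pder j f) x (EuclideanSpace.single i 1) = pder i (pder j f) x :=
      fun j => rfl
    simp only [smul_apply, add_apply, Function.comp_apply,
      sum_apply, smul_eq_mul, e]
    rw [← hq, ← hs, ← hs2]
    have e2 : ∑ j, 2 * pder j f x * pder i (pder j f) x
      = 2 * ∑ j, pder j f x * pder i (pder j f) x := by
      rw [Finset.mul_sum]; simp_rw [mul_assoc]
    have e3 : ∑ j, pder i f x * pder j f x * pder i (pder j f) x
      = pder i f x * ∑ j, pder j f x * pder i (pder j f) x := by
      rw [Finset.mul_sum]; simp_rw [mul_assoc]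
    rw [e2, e3]
    field_simp
    ring
  rw [Finset.mul_sum, Finset.sum_congr rfl fun i _ => hterm i, Finset.sum_sub_distrib,
    ← Finset.sum_div]
  change _ ≤ lap f x * (lap f x - _)
  set A := ∑ i, ∑ j, pder i f x * pder j f x * pder i (pder j f) x with hA
  have hCS : A ^ 2 ≤ q ^ 2 * hessSq f x := by
    have := Finset.sum_mul_sq_le_sq_mul_sq (Finset.univ : Finset (Fin d × Fin d))
      (fun z => pder z.1 f x * pder z.2 f x) (fun z => pder z.1 (pder z.2 f) x)
    rw [Fintype.sum_prod_type, Fintype.sum_prod_type, Fintype.sum_prod_type] at this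
    refine this.trans (le_of_eq ?_)
    congr 1
    rw [hq, sq, gradSq, Finset.sum_mul_sum]
    simp_rw [mul_pow]
  have hH0 : 0 ≤ hessSq f x :=
    Finset.sum_nonneg fun i _ => Finset.sum_nonneg fun j _ => sq_nonneg _
  have hB : (A / (1 + q)) ^ 2 ≤ hessSq f x := by
    rw [div_pow, div_le_iff₀ (by positivity)]
    refine hCS.trans ?_
    rw [mul_comm]
    have := hg0 x
    gcongr
    linarith
  nlinarith [sq_nonneg (lap f x - A / (1 + q))]

lemma hasDeriv_int {Q : ℝ × EuclideanSpace ℝ (Fin d) → ℝ} (hQ : ContDiff ℝ ∞ Q) (t : ℝ) :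
    HasDerivAt (fun s => ∫ x in fundDom d, Q (s, x))
      (∫ x in fundDom d, fderiv ℝ Q (t, x) (1, 0)) t := by
  have hQ' : Continuous fun z => fderiv ℝ Q z (1, 0) :=
    ((hQ.fderiv_right (m := ∞) (by simp)).clm_apply contDiff_const).continuous
  have hc : IsCompact (Set.Icc (t-1) (t+1) ×ˢ
      ((WithLp.toLp 2 : _ → EuclideanSpace ℝ (Fin d)) '' (Set.Icc (0 : Fin d → ℝ) 1))) :=
    isCompact_Icc.prod (isCompact_Icc.image (PiLp.continuous_toLp 2 _))
  obtain ⟨C, hC⟩ := hc.exists_bound_of_continuousOn hQ'.continuousOn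
  refine (hasDerivAt_integral_of_dominated_loc_of_deriv_le (s := Set.Icc (t-1) (t+1))
    (F := fun s x => Q (s, x)) (F' := fun s x => fderiv ℝ Q (s, x) (1, 0)) (bound := fun _ => C)
    (Icc_mem_nhds (by linarith) (by linarith)) ?_ ?_ ?_ ?_ ?_ ?_).2
  · refine Filter.Eventually.of_forall fun s => ?_
    exact (hQ.continuous.comp (by fun_prop : Continuous fun x => (s, x))).aestronglyMeasurable
  · exact integrable_fund (hQ.continuous.comp (by fun_prop : Continuous fun x => (t, x)))
  · exact (hQ'.comp (by fun_prop : Continuous fun x => (t, x))).aestronglyMeasurable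
  · refine (ae_restrict_iff' meas_fund).2 (Filter.Eventually.of_forall fun x hx s hs => ?_)
    exact hC (s, x) ⟨hs, x.ofLp, ⟨fun i => (hx i).1, fun i => (hx i).2.le⟩, rfl⟩
  · exact integrable_fund continuous_const
  · refine Filter.Eventually.of_forall fun x s _ => ?_
    have h1 := (hQ.differentiable (by simp) (s, x)).hasFDerivAt
    have h2 : HasDerivAt (fun s : ℝ => (s, x)) ((1 : ℝ), (0 : EuclideanSpace ℝ (Fin d))) s :=
      (hasDerivAt_id s).prodMk (hasDerivAt_const s x)
    exact h1.comp_hasDerivAt s h2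

lemma pder_slice {f : ℝ × EuclideanSpace ℝ (Fin d) → ℝ} (hf : ContDiff ℝ ∞ f) (i : Fin d) (s x) :
    pder i (fun y => f (s, y)) x = fderiv ℝ f (s, x) (0, EuclideanSpace.single i 1) := by
  have h1 := (hf.differentiable (by simp) (s, x)).hasFDerivAt
  have h2 := h1.comp x (hasFDerivAt_prodMk_right s x)
  unfold pder
  have h3 := h2.fderiv
  rw [show (fun y => f (s, y)) = f ∘ (fun y => (s, y)) from rfl, h3]
  simp

lemma deriv_slice {f : ℝ × EuclideanSpace ℝ (Fin d) → ℝ} (hf : ContDiff ℝ ∞ f) (s x) :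
    deriv (fun s => f (s, x)) s = fderiv ℝ f (s, x) (1, 0) := by
  have h1 := (hf.differentiable (by simp) (s, x)).hasFDerivAt
  have h2 : HasDerivAt (fun s : ℝ => (s, x)) ((1 : ℝ), (0 : EuclideanSpace ℝ (Fin d))) s :=
    (hasDerivAt_id s).prodMk (hasDerivAt_const s x)
  exact (h1.comp_hasDerivAt s h2).deriv

lemma fder_smooth {f : ℝ × EuclideanSpace ℝ (Fin d) → ℝ} (hf : ContDiff ℝ ∞ f) (v) :
    ContDiff ℝ ∞ (fun z => fderiv ℝ f z v) :=
  (hf.fderiv_right (m := ∞) (by simp)).clm_apply contDiff_const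

lemma fder_comm {f : ℝ × EuclideanSpace ℝ (Fin d) → ℝ} (hf : ContDiff ℝ ∞ f) (v w z) :
    fderiv ℝ (fun z => fderiv ℝ f z v) z w = fderiv ℝ (fun z => fderiv ℝ f z w) z v := by
  have hd : DifferentiableAt ℝ (fderiv ℝ f) z :=
    (hf.fderiv_right (m := ∞) (by simp)).contDiffAt.differentiableAt (by simp)
  rw [fderiv_clm_apply hd (by fun_prop), fderiv_clm_apply hd (by fun_prop)]
  simpa using (hf.contDiffAt.isSymmSndFDerivAt (by simp; exact WithTop.coe_le_coe.2 (le_top : (2 : ℕ∞) ≤ ⊤))) w v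

/-- Decay of `∫|∇h|²` along the mean-curvature equation
`∂ₜh + √(1+|∇h|²) κ = 0` with `κ = −div(∇h/√(1+|∇h|²))` on `𝕋^d`
(Proposition `Prop:C1nabla`). -/
theorem meancurvature_gradL2_decay (d : ℕ) (hd : 1 ≤ d)
    (T : ℝ) (h : ℝ × EuclideanSpace ℝ (Fin d) → ℝ)
    (hsm : ContDiff ℝ (⊤ : ℕ∞) h)
    (hper : ∀ t, ZPeriodic (fun x => h (t, x)))
    (heq : ∀ t ∈ Set.Icc (0 : ℝ) T, ∀ x,
      deriv (fun s => h (s, x)) t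
        + Real.sqrt (1 + gradSq (fun z => h (t, z)) x) *
          (-(∑ i, pder i (fun y =>
              pder i (fun z => h (t, z)) y /
                Real.sqrt (1 + gradSq (fun z => h (t, z)) y)) x)) = 0) :
    ∀ t ∈ Set.Icc (0 : ℝ) T,
      deriv (fun s => ∫ x in fundDom d, gradSq (fun y => h (s, y)) x) t ≤ 0 := by

  intro t ht
  have hsm' : ContDiff ℝ ∞ h := hsm
  set f : EuclideanSpace ℝ (Fin d) → ℝ := fun x => h (t, x) with hfdef
  have hf : ContDiff ℝ ∞ f := hsm'.comp (contDiff_prodMk_right t)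
  have hp : ZPeriodic f := hper t
  set w : EuclideanSpace ℝ (Fin d) → ℝ := fun x => fderiv ℝ h (t, x) (1, 0) with hw
  have hws : ContDiff ℝ ∞ w := (fder_smooth hsm' (1, 0)).comp (contDiff_prodMk_right t)
  have hwp : ZPeriodic w := by
    intro x k
    simp only [hw]
    rw [← deriv_slice hsm', ← deriv_slice hsm']
    congr 1
    funext s
    exact hper s x k
  have hQs : ContDiff ℝ ∞ (fun z : ℝ × EuclideanSpace ℝ (Fin d) =>
      ∑ i, (fderiv ℝ h z (0, EuclideanSpace.single i 1)) ^ 2) :=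
    ContDiff.sum fun i _ => (fder_smooth hsm' _).pow 2
  have hD := (hasDeriv_int hQs t).deriv
  have hfun : (fun s => ∫ x in fundDom d, gradSq (fun y => h (s, y)) x)
      = fun s => ∫ x in fundDom d, ∑ i, (fderiv ℝ h (s, x) (0, EuclideanSpace.single i 1)) ^ 2 := by
    funext s
    simp_rw [gradSq, pder_slice hsm']
  rw [hfun, hD]
  have hint : ∀ x, fderiv ℝ (fun z : ℝ × EuclideanSpace ℝ (Fin d) =>
      ∑ i, (fderiv ℝ h z (0, EuclideanSpace.single i 1)) ^ 2) (t, x) (1, 0)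
      = 2 * ∑ i, pder i f x * pder i w x := by
    intro x
    have h1 : HasFDerivAt (fun z : ℝ × EuclideanSpace ℝ (Fin d) =>
      ∑ i, (fderiv ℝ h z (0, EuclideanSpace.single i 1)) ^ 2)
      (∑ i, (2 * fderiv ℝ h (t, x) (0, EuclideanSpace.single i 1)) •
        fderiv ℝ (fun z => fderiv ℝ h z (0, EuclideanSpace.single i 1)) (t, x)) (t, x) := by
      refine HasFDerivAt.fun_sum fun i _ => ?_
      simpa using
        ((fder_smooth hsm' (0, EuclideanSpace.single i 1)).differentiable (by simp)
          (t, x)).hasFDerivAt.pow 2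
    rw [h1.fderiv, sum_apply, Finset.mul_sum]
    refine Finset.sum_congr rfl fun i _ => ?_
    rw [smul_apply, fder_comm hsm', hfdef, pder_slice hsm', hw,
      pder_slice (fder_smooth hsm' (1, 0)), smul_eq_mul, mul_assoc]
  simp_rw [hint]
  rw [integral_const_mul, integral_finsetSum _ fun i _ => integrable_fund
    ((pder_smooth i hf).mul (pder_smooth i hws)).continuous,
    Finset.sum_congr rfl fun i _ => ibp i (pder_smooth i hf) hws (pder_per i hp) hwp,
    Finset.sum_neg_distrib, ← integral_finsetSum _ fun i _ => integrable_fund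
    ((pder_smooth i (pder_smooth i hf)).mul hws).continuous]
  simp_rw [← Finset.sum_mul]
  change 2 * -(∫ x in fundDom d, lap f x * w x) ≤ 0
  have hmain : ∫ x in fundDom d, (lap f x ^ 2 - hessSq f x) / 2
      ≤ ∫ x in fundDom d, lap f x * w x := by
    refine integral_mono
      (integrable_fund ((((lap_smooth hf).pow 2).sub (hess_smooth hf)).div_const 2).continuous)
      (integrable_fund ((lap_smooth hf).mul hws).continuous) fun x => ?_
    have h1 := heq t ht x
    rw [deriv_slice hsm'] at h1
    have h2 : w x = Real.sqrt (1 + gradSq f x) *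
      ∑ i, pder i (fun y => pder i f y / Real.sqrt (1 + gradSq f y)) x := by
      simp only [hw, hfdef]
      linarith
    simp only [h2]
    exact pointwise hf x
  rw [integral_div, integral_sub (integrable_fund ((lap_smooth hf).pow 2).continuous)
    (integrable_fund (hess_smooth hf).continuous), int_lap_sq hf hp] at hmain
  linarith
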